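/- Let F : U → ℝ be differentiable and convex with minimizer u* on a real Hilbert space, and let g_j be an unbiased estimator of ∇F(u_j) conditional on the past, with update u_{j+1} = u_j - η_j g_j where η_j, u_j are measurable with respect to the past. Then E[∑_{j=1}^n η_j (F(u_j) - F(u*))] ≤ ½‖u₁ - u*‖² + ½ E[∑_{j=1}^n η_j² ‖g_j‖²]. -/

import Mathlib

open MeasureTheory

/-- The first-order characterization of convexity: the graph of a convex function lies above its
tangent hyperplanes. -/
lemma ConvexOn.sub_le_inner_of_hasGradientAt {U : Type*} [NormedAddCommGroup U]
    [InnerProductSpace ℝ U] [CompleteSpace U] {F : U → ℝ} {x d : U}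
    (hF : ConvexOn ℝ Set.univ F) (hd : HasGradientAt F d x) (y : U) :
    F x - F y ≤ inner ℝ (x - y) d := by
  have hconv : ConvexOn ℝ Set.univ (F ∘ AffineMap.lineMap (k := ℝ) x y) := by
    simpa using hF.comp_affineMap (AffineMap.lineMap (k := ℝ) x y)
  have hline : HasDerivAt (AffineMap.lineMap (k := ℝ) x y) (y - x) (0 : ℝ) :=
    AffineMap.hasDerivAt_lineMap
  have hderiv : HasDerivAt (F ∘ AffineMap.lineMap (k := ℝ) x y) (inner ℝ d (y - x)) 0 := by
    have hd' : HasFDerivAt F (InnerProductSpace.toDual ℝ U d)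
        (AffineMap.lineMap (k := ℝ) x y 0) := by
      simpa using hd.hasFDerivAt
    simpa using hd'.comp_hasDerivAt (0 : ℝ) hline
  have h := hconv.le_slope_of_hasDerivAt (Set.mem_univ 0) (Set.mem_univ 1) one_pos hderiv
  simp only [slope_def_field, Function.comp_apply, AffineMap.lineMap_apply_one,
    AffineMap.lineMap_apply_zero, sub_zero, div_one] at h
  rw [← neg_sub y x, inner_neg_left, real_inner_comm]
  linarith

/-- The terms of an integrable finite sum of nonnegative measurable functions are integrable. -/
lemma MeasureTheory.Integrable.of_finset_sum_of_nonneg {Ω ι : Type*} {m : MeasurableSpace Ω}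
    {μ : Measure Ω} {s : Finset ι} {f : ι → Ω → ℝ}
    (hf : ∀ i ∈ s, AEStronglyMeasurable (f i) μ) (hf0 : ∀ i ω, 0 ≤ f i ω)
    (hsum : Integrable (fun ω => ∑ i ∈ s, f i ω) μ) {i : ι} (hi : i ∈ s) :
    Integrable (f i) μ := by
  refine hsum.mono' (hf i hi) (ae_of_all _ fun ω => ?_)
  rw [Real.norm_of_nonneg (hf0 i ω)]
  exact Finset.single_le_sum (f := fun i => f i ω) (fun i _ => hf0 i ω) hi

/-- The inner product of two square-integrable functions is integrable. -/
lemma MeasureTheory.MemLp.integrable_inner_of_two {Ω U : Type*} {m : MeasurableSpace Ω}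
    {μ : Measure Ω} [NormedAddCommGroup U] [InnerProductSpace ℝ U] {f g : Ω → U}
    (hf : MemLp f 2 μ) (hg : MemLp g 2 μ) : Integrable (fun ω => inner ℝ (f ω) (g ω)) μ :=
  (hf.norm.integrable_mul hg.norm).mono' (hf.1.inner hg.1)
    (ae_of_all _ fun ω => norm_inner_le_norm (f ω) (g ω))

/-- One step of stochastic gradient descent with a predictable step size: the expected decrease of
the squared distance to `c` controls the expected optimality gap. -/
lemma integral_stepSize_mul_gap_le {Ω U : Type*} {m₀ m : MeasurableSpace Ω} {μ : Measure Ω}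
    [IsProbabilityMeasure μ] (hm : m₀ ≤ m)
    [NormedAddCommGroup U] [InnerProductSpace ℝ U] [CompleteSpace U]
    {F : U → ℝ} {gradF : U → U} {c : U}
    (hdiff : ∀ w, HasGradientAt F (gradF w) w) (hconv : ConvexOn ℝ Set.univ F)
    (hmin : ∀ w, F c ≤ F w) {x g : Ω → U} {η : Ω → ℝ} (hη : ∀ ω, 0 < η ω)
    (hxm : StronglyMeasurable[m₀] x) (hηm : StronglyMeasurable[m₀] η)
    (hg : Integrable g μ) (hunbiased : μ[g | m₀] =ᵐ[μ] fun ω => gradF (x ω))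
    (hx : MemLp (fun ω => x ω - c) 2 μ) (hηg : MemLp (fun ω => η ω • g ω) 2 μ) :
    ∫ ω, η ω * (F (x ω) - F c) ∂μ ≤
      1 / 2 * ∫ ω, ‖x ω - c‖ ^ 2 ∂μ - 1 / 2 * ∫ ω, ‖x ω - η ω • g ω - c‖ ^ 2 ∂μ +
        1 / 2 * ∫ ω, η ω ^ 2 * ‖g ω‖ ^ 2 ∂μ := by
  have hinner : ∀ ω, inner ℝ (x ω - c) (η ω • g ω) = innerSL ℝ (η ω • (x ω - c)) (g ω) := by
    intro ω
    simp only [innerSL_apply_apply, real_inner_smul_left, real_inner_smul_right]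
  have hint := hx.integrable_inner_of_two hηg
  have hpull : μ[fun ω => inner ℝ (x ω - c) (η ω • g ω) | m₀] =ᵐ[μ]
      fun ω => η ω * inner ℝ (x ω - c) (gradF (x ω)) := by
    simp only [hinner] at hint ⊢
    have hw : StronglyMeasurable[m₀] fun ω => η ω • (x ω - c) :=
      hηm.smul (hxm.sub stronglyMeasurable_const)
    have h := condExp_bilin_of_stronglyMeasurable_left (innerSL ℝ) hw hint hg
    filter_upwards [h, hunbiased] with ω h₁ h₂
    rw [h₁, h₂, innerSL_apply_apply, real_inner_smul_left]
  have hgap : ∫ ω, η ω * (F (x ω) - F c) ∂μ ≤ ∫ ω, inner ℝ (x ω - c) (η ω • g ω) ∂μ := by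
    rw [← integral_condExp hm (f := fun ω => inner ℝ (x ω - c) (η ω • g ω))]
    refine integral_mono_of_nonneg (ae_of_all _ fun ω => ?_) integrable_condExp ?_
    · exact mul_nonneg (hη ω).le (sub_nonneg.2 (hmin _))
    · filter_upwards [hpull] with ω hω
      rw [hω]
      exact mul_le_mul_of_nonneg_left (hconv.sub_le_inner_of_hasGradientAt (hdiff _) c) (hη ω).le
  have hnext : ∫ ω, ‖x ω - η ω • g ω - c‖ ^ 2 ∂μ =
      ∫ ω, ‖x ω - c‖ ^ 2 ∂μ - 2 * ∫ ω, inner ℝ (x ω - c) (η ω • g ω) ∂μ +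
        ∫ ω, ‖η ω • g ω‖ ^ 2 ∂μ := by
    have hx2 : Integrable (fun ω => ‖x ω - c‖ ^ 2) μ := (memLp_two_iff_integrable_sq_norm hx.1).1 hx
    have hηg2 : Integrable (fun ω => ‖η ω • g ω‖ ^ 2) μ :=
      (memLp_two_iff_integrable_sq_norm hηg.1).1 hηg
    rw [← integral_const_mul, ← integral_sub hx2 (hint.const_mul 2),
      ← integral_add (by exact hx2.sub (hint.const_mul 2)) hηg2]
    refine integral_congr_ae (ae_of_all _ fun ω => ?_)
    simp only [sub_right_comm (x ω) _ c]
    exact norm_sub_sq_real _ _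
  simp only [norm_smul, mul_pow, Real.norm_eq_abs, sq_abs] at hnext
  linarith

open MeasureTheory in
/-- Inequality (24) in the AdaGrad convergence proof: for the stochastic gradient update
with unbiased gradients and past-measurable step sizes,
`E[∑ η_j (F(u_j) - F(u*))] ≤ ½‖u₁ - u*‖² + ½ E[∑ η_j² ‖g_j‖²]`. -/
theorem stmt_11
    {Ω : Type*} {m : MeasurableSpace Ω} (μ : Measure Ω) [IsProbabilityMeasure μ]
    (ℱ : Filtration ℕ m)
    {U : Type*} [NormedAddCommGroup U] [InnerProductSpace ℝ U] [CompleteSpace U]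
    [MeasurableSpace U] [BorelSpace U] [SecondCountableTopology U]
    (F : U → ℝ) (gradF : U → U) (ustar : U)
    (hdiff : ∀ w : U, HasGradientAt F (gradF w) w)
    (hconv : ConvexOn ℝ Set.univ F)
    (hmin : ∀ w : U, F ustar ≤ F w)
    (u g : ℕ → Ω → U) (η : ℕ → Ω → ℝ) (u1 : U)
    (hu1 : ∀ ω, u 0 ω = u1)
    (hupdate : ∀ j ω, u (j + 1) ω = u j ω - η j ω • g j ω)
    (hηpos : ∀ j ω, 0 < η j ω)
    (huadapted : ∀ j, StronglyMeasurable[ℱ j] (u j))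
    (hηadapted : ∀ j, StronglyMeasurable[ℱ j] (η j))
    (hgint : ∀ j, Integrable (g j) μ)
    (hunbiased : ∀ j, μ[g j | ℱ j] =ᵐ[μ] fun ω => gradF (u j ω))
    (n : ℕ)
    (hint1 : Integrable (fun ω => ∑ j ∈ Finset.range n,
      η j ω * (F (u j ω) - F ustar)) μ)
    (hint2 : Integrable (fun ω => ∑ j ∈ Finset.range n,
      (η j ω) ^ 2 * ‖g j ω‖ ^ 2) μ) :
    ∫ ω, (∑ j ∈ Finset.range n, η j ω * (F (u j ω) - F ustar)) ∂μ
      ≤ 1 / 2 * ‖u1 - ustar‖ ^ 2 +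
        1 / 2 * ∫ ω, (∑ j ∈ Finset.range n, (η j ω) ^ 2 * ‖g j ω‖ ^ 2) ∂μ := by
  have hF : Continuous F :=
    continuous_iff_continuousAt.2 fun w => (hdiff w).hasFDerivAt.continuousAt
  have hηm : ∀ j, AEStronglyMeasurable (η j) μ := fun j =>
    ((hηadapted j).mono (ℱ.le j)).aestronglyMeasurable
  have hum : ∀ j, AEStronglyMeasurable (u j) μ := fun j =>
    ((huadapted j).mono (ℱ.le j)).aestronglyMeasurable
  have hgap : ∀ j ∈ Finset.range n, Integrable (fun ω => η j ω * (F (u j ω) - F ustar)) μ :=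
    fun j hj => Integrable.of_finset_sum_of_nonneg
      (f := fun j ω => η j ω * (F (u j ω) - F ustar))
      (fun i _ => (hηm i).mul ((hF.comp_aestronglyMeasurable (hum i)).sub
        aestronglyMeasurable_const))
      (fun i ω => mul_nonneg (hηpos i ω).le (sub_nonneg.2 (hmin _))) hint1 hj
  have hsq : ∀ j ∈ Finset.range n, Integrable (fun ω => η j ω ^ 2 * ‖g j ω‖ ^ 2) μ :=
    fun j hj => Integrable.of_finset_sum_of_nonneg (f := fun j ω => η j ω ^ 2 * ‖g j ω‖ ^ 2)
      (fun i _ => ((hηm i).pow 2).mul ((hgint i).1.norm.pow 2))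
      (fun i ω => by positivity) hint2 hj
  have hηg : ∀ j ∈ Finset.range n, MemLp (fun ω => η j ω • g j ω) 2 μ := by
    intro j hj
    refine (memLp_two_iff_integrable_sq_norm ((hηm j).smul (hgint j).1)).2 ?_
    simpa only [Pi.smul_apply', norm_smul, mul_pow, Real.norm_eq_abs, sq_abs] using hsq j hj
  have hu : ∀ j ≤ n, MemLp (fun ω => u j ω - ustar) 2 μ := by
    intro j
    induction j with
    | zero => intro _; simpa only [hu1] using memLp_const (u1 - ustar)
    | succ j ih =>
      intro hj
      have h := (ih (by lia)).sub (hηg j (Finset.mem_range.2 hj))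
      refine h.congr_norm ?_ (ae_of_all _ fun ω => ?_)
      · exact (hum (j + 1)).sub aestronglyMeasurable_const
      · simp only [hupdate, Pi.sub_apply, sub_right_comm]
  have hstep : ∀ j ∈ Finset.range n, ∫ ω, η j ω * (F (u j ω) - F ustar) ∂μ ≤
      (1 / 2 * ∫ ω, ‖u j ω - ustar‖ ^ 2 ∂μ - 1 / 2 * ∫ ω, ‖u (j + 1) ω - ustar‖ ^ 2 ∂μ) +
        1 / 2 * ∫ ω, η j ω ^ 2 * ‖g j ω‖ ^ 2 ∂μ := by
    intro j hj
    simp only [hupdate]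
    exact integral_stepSize_mul_gap_le (ℱ.le j) hdiff hconv hmin (hηpos j) (huadapted j)
      (hηadapted j) (hgint j) (hunbiased j) (hu j (Finset.mem_range.1 hj).le) (hηg j hj)
  rw [integral_finsetSum _ hgap, integral_finsetSum _ hsq]
  have h := Finset.sum_le_sum hstep
  rw [Finset.sum_add_distrib,
    Finset.sum_range_sub' (fun j => 1 / 2 * ∫ ω, ‖u j ω - ustar‖ ^ 2 ∂μ), ← Finset.mul_sum] at h
  have h0 : ∫ ω, ‖u 0 ω - ustar‖ ^ 2 ∂μ = ‖u1 - ustar‖ ^ 2 := by simp [hu1]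
  have hn : 0 ≤ ∫ ω, ‖u n ω - ustar‖ ^ 2 ∂μ := integral_nonneg fun ω => by positivity
  linarith
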